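/- Let β ≥ 2 be an integer, let f : ℝ^d → ℝ be convex, differentiable, and β-th order smooth with constant M_β, let δ > 0, and let k : [−1,1] → ℝ be a bounded measurable kernel satisfying E_r[r k(r)] = 1 and E_r[r^s k(r)] = 0 for every odd integer s with 3 ≤ s ≤ β, where r is uniform on [−1,1]. Then for every x ∈ ℝ^d, ‖∇f̂_δ(x) − ∇f(x)‖₂ ≤ (M_β^β / (β−1)!) · δ^{β−1} · E_r[|k(r) r^β|]. -/

import Mathlib

open MeasureTheory Metric

/-- The uniform probability distribution on the interval `[-1, 1] ⊆ ℝ`. -/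
noncomputable def intervalUniform : Measure ℝ :=
  (2 : ENNReal)⁻¹ • (volume.restrict (Set.Icc (-1 : ℝ) 1))

/-- The uniform probability distribution on the closed Euclidean unit ball of `ℝ^d`. -/
noncomputable def ballUniform (d : ℕ) : Measure (EuclideanSpace ℝ (Fin d)) :=
  (volume (closedBall (0 : EuclideanSpace ℝ (Fin d)) 1))⁻¹ •
    (volume.restrict (closedBall (0 : EuclideanSpace ℝ (Fin d)) 1))

/-- The smoothed version `f̂_δ` of `f : ℝ^d → ℝ`:
`f̂_δ(x) = E[f(x + r δ v) r k(r)]` where `r` is uniform on `[-1,1]` and `v` is independent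
of `r`, uniform on the closed unit ball. -/
noncomputable def smoothed (d : ℕ) (f : EuclideanSpace ℝ (Fin d) → ℝ) (δ : ℝ) (k : ℝ → ℝ)
    (x : EuclideanSpace ℝ (Fin d)) : ℝ :=
  ∫ p : ℝ × EuclideanSpace ℝ (Fin d), f (x + (p.1 * δ) • p.2) * (p.1 * k p.1)
    ∂(intervalUniform.prod (ballUniform d))

/-- `f : ℝ^d → ℝ` is `β`-th order smooth with constant `M`: it is `(β-1)`-times continuously
differentiable and its `(β-1)`-th directional derivatives are `M^β`-Lipschitz. -/
def HigherOrderSmooth (d β : ℕ) (M : ℝ) (f : EuclideanSpace ℝ (Fin d) → ℝ) : Prop :=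
  ContDiff ℝ (β - 1 : ℕ) f ∧
    ∀ (x y v : EuclideanSpace ℝ (Fin d)), ‖v‖ = 1 →
      |iteratedFDeriv ℝ (β - 1) f x (fun _ => v) - iteratedFDeriv ℝ (β - 1) f y (fun _ => v)|
        ≤ M ^ β * ‖x - y‖


lemma banach_norm_aux {E : Type*} [NormedAddCommGroup E] [InnerProductSpace ℝ E]
    {n : ℕ} (A : ContinuousMultilinearMap ℝ (fun _ : Fin n => E) ℝ) (L : ℝ)
    (h : ∀ m : Fin n → E, (∀ i, ‖m i‖ = 1) → |A m| ≤ L) (m : Fin n → E) :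
    |A m| ≤ L * ∏ i, ‖m i‖ := by
  by_cases hz : ∃ i, m i = 0
  · obtain ⟨i, hi⟩ := hz
    rw [A.map_coord_zero i hi, Finset.prod_eq_zero (Finset.mem_univ i) (by simp [hi])]
    simp
  · push Not at hz
    have h1 : m = fun i => ‖m i‖ • (‖m i‖⁻¹ • m i) := by
      funext i
      rw [smul_smul, mul_inv_cancel₀ (norm_ne_zero_iff.2 (hz i)), one_smul]
    have h2 : A m = (∏ i, ‖m i‖) * A (fun i => ‖m i‖⁻¹ • m i) := by
      conv_lhs => rw [h1]
      rw [A.map_smul_univ, smul_eq_mul]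
    have h3 := h (fun i => ‖m i‖⁻¹ • m i) (fun i => by
      rw [norm_smul, norm_inv, norm_norm, inv_mul_cancel₀ (norm_ne_zero_iff.2 (hz i))])
    have h4 : 0 ≤ ∏ i, ‖m i‖ := Finset.prod_nonneg fun i _ => norm_nonneg _
    rw [h2, abs_mul, abs_of_nonneg h4, mul_comm]
    gcongr

lemma banach_step {E : Type*} [NormedAddCommGroup E] [InnerProductSpace ℝ E]
    {n : ℕ} (A : ContinuousMultilinearMap ℝ (fun _ : Fin n => E) ℝ)
    (hsymm : ∀ (σ : Equiv.Perm (Fin n)) (m : Fin n → E), A (fun i => m (σ i)) = A m)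
    (L : ℝ) (hL : ∀ m : Fin n → E, |A m| ≤ L * ∏ i, ‖m i‖)
    (m : Fin n → E) (hm : ∀ i, ‖m i‖ = 1) (hmL : |A m| = L) (i k : Fin n) (hik : i ≠ k) :
    L * ‖m i + m k‖ ^ 2 ≤
      |A (Function.update (Function.update m i (m i + m k)) k (m i + m k))| := by
  set B : E → E → ℝ := fun a b => A (Function.update (Function.update m i a) k b) with hB
  have hBs : ∀ a b, B a b = B b a := by
    intro a b
    simp only [hB]
    rw [← hsymm (Equiv.swap i k)]
    congr 1
    funext j
    by_cases hj : j = i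
    · subst hj; simp [Function.update_of_ne hik]
    · by_cases hj' : j = k
      · subst hj'; simp [Function.update_of_ne hik]
      · rw [Equiv.swap_apply_of_ne_of_ne hj hj']
        simp [hj, hj']
  have hBa : ∀ a b c, B a (b + c) = B a b + B a c := fun a b c => A.map_update_add _ _ _ _
  have hBn : ∀ a b, B a (-b) = - B a b := fun a b => by
    have := A.map_update_smul (Function.update m i a) k (-1) b
    simpa [hB] using this
  have hBb : ∀ a b, |B a b| ≤ L * (‖a‖ * ‖b‖) := by
    intro a b
    refine (hL _).trans (le_of_eq ?_)
    rw [Finset.prod_eq_mul i k hik]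
    · simp [hik]
    · rintro j - ⟨h1, h2⟩
      simp [h1, h2, hm]
    · simp
    · simp
  have hB0 : B (m i) (m k) = A m := by simp [hB]
  have e1 : B (m i + m k) (m i + m k) = B (m i) (m i) + 2 * B (m i) (m k) + B (m k) (m k) := by
    rw [hBa, hBs _ (m i), hBs _ (m k), hBa, hBa, hBs (m k) (m i)]; ring
  have e2 : B (m i - m k) (m i - m k) = B (m i) (m i) - 2 * B (m i) (m k) + B (m k) (m k) := by
    rw [sub_eq_add_neg, hBa, hBn, hBs _ (m i), hBs _ (m k), hBa, hBa, hBn, hBn,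
      hBs (m k) (m i)]; ring
  have e3 : 4 * B (m i) (m k) = B (m i + m k) (m i + m k) - B (m i - m k) (m i - m k) := by
    rw [e1, e2]; ring
  have e4 : 4 * L ≤ |B (m i + m k) (m i + m k)| + |B (m i - m k) (m i - m k)| := by
    rw [← hmL, ← hB0]
    calc 4 * |B (m i) (m k)| = |4 * B (m i) (m k)| := by rw [abs_mul]; norm_num
      _ ≤ _ := by rw [e3]; exact abs_sub _ _
  have e5 := hBb (m i - m k) (m i - m k)
  have e6 := parallelogram_law_with_norm ℝ (m i) (m k)
  rw [hm, hm] at e6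
  change _ ≤ |B (m i + m k) (m i + m k)|
  have : L * (‖m i - m k‖ * ‖m i - m k‖) = 4 * L - L * ‖m i + m k‖ ^ 2 := by
    have : ‖m i - m k‖ * ‖m i - m k‖ = 4 - ‖m i + m k‖ ^ 2 := by linarith
    rw [this]; ring
  linarith

lemma banach_symm {E : Type*} [NormedAddCommGroup E] [InnerProductSpace ℝ E]
    [FiniteDimensional ℝ E] {n : ℕ}
    (A : ContinuousMultilinearMap ℝ (fun _ : Fin (n+1) => E) ℝ)
    (hsymm : ∀ (σ : Equiv.Perm (Fin (n+1))) (m : Fin (n+1) → E), A (fun i => m (σ i)) = A m)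
    (C : ℝ) (hC : ∀ v : E, ‖v‖ = 1 → |A (fun _ => v)| ≤ C) (m : Fin (n+1) → E) :
    |A m| ≤ C * ∏ i, ‖m i‖ := by
  apply banach_norm_aux
  clear m
  intro m0 hm0
  have hprop : ProperSpace E := FiniteDimensional.proper ℝ E
  set K : Set (Fin (n+1) → E) := Set.pi Set.univ (fun _ => sphere (0:E) 1) with hK
  have hKc : IsCompact K := isCompact_univ_pi fun _ => isCompact_sphere _ _
  have hKm : ∀ m, m ∈ K ↔ ∀ i, ‖m i‖ = 1 := by intro m; simp [hK]
  have hcont : Continuous fun m : Fin (n+1) → E => |A m| := A.cont.abs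
  obtain ⟨m1, hm1, hmax1⟩ := hKc.exists_isMaxOn ⟨m0, (hKm _).2 hm0⟩ hcont.continuousOn
  set L := |A m1| with hLdef
  have hL1 : ∀ m : Fin (n+1) → E, (∀ i, ‖m i‖ = 1) → |A m| ≤ L := fun m hm =>
    hmax1 ((hKm _).2 hm)
  have hL := banach_norm_aux A L hL1
  refine (hL1 m0 hm0).trans ?_
  set S : Set (Fin (n+1) → E) := K ∩ {m | |A m| = L} with hS
  have hSc : IsCompact S := hKc.inter_right (isClosed_eq hcont continuous_const)
  set e := m1 0 with he
  set ψ : (Fin (n+1) → E) → ℝ := fun m => ∑ i, |inner ℝ (m i) e| with hψ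
  have hψc : Continuous ψ := by fun_prop
  obtain ⟨m2, hm2, hmax2⟩ := hSc.exists_isMaxOn ⟨m1, hm1, rfl⟩ hψc.continuousOn
  -- flip signs
  set s : Fin (n+1) → ℝ := fun i => if inner ℝ (m2 i) e < 0 then -1 else 1 with hs
  have hs1 : ∀ i, |s i| = 1 := by
    intro i; simp only [hs]; split_ifs <;> simp
  set m3 : Fin (n+1) → E := fun i => s i • m2 i with hm3
  have hm3n : ∀ i, ‖m3 i‖ = 1 := by
    intro i
    rw [hm3]; simp only [norm_smul, Real.norm_eq_abs, hs1, (hKm _).1 hm2.1 i, mul_one]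
  have hm3L : |A m3| = L := by
    rw [hm3, A.map_smul_univ, smul_eq_mul, abs_mul, Finset.abs_prod]
    simp only [hs1, Finset.prod_const_one, one_mul]
    exact hm2.2
  have hin : ∀ i, inner ℝ (m3 i) e = |inner ℝ (m2 i) e| := by
    intro i
    simp only [hm3, hs]
    split_ifs with h
    · rw [abs_of_neg h]; simp
    · rw [abs_of_nonneg (not_lt.1 h)]; simp
  have hpos : ∀ i, 0 ≤ inner ℝ (m3 i) e := fun i => by rw [hin]; positivity
  have hψ3 : ∀ m, (∀ i, ‖m i‖ = 1) → |A m| = L → ψ m ≤ ψ m3 := by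
    intro m h1 h2
    have h3 : ψ m ≤ ψ m2 := hmax2 ⟨(hKm _).2 h1, h2⟩
    refine h3.trans (le_of_eq ?_)
    simp only [hψ, hin, abs_abs]
  have hψpos : 0 < ψ m3 := by
    have h1 := hψ3 m1 ((hKm _).1 hm1) rfl
    have h2 : |inner ℝ (m1 0) e| ≤ ψ m1 :=
      Finset.single_le_sum (f := fun i => |inner ℝ (m1 i) e|) (fun i _ => abs_nonneg _)
        (Finset.mem_univ 0)
    rw [← he, real_inner_self_eq_norm_sq, he, (hKm _).1 hm1 0] at h2
    norm_num at h2
    linarith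
  obtain ⟨k, -, hk⟩ : ∃ k ∈ Finset.univ, 0 < |inner ℝ (m3 k) e| := by
    by_contra hcon
    push Not at hcon
    exact absurd (Finset.sum_nonpos hcon) (not_le.2 hψpos)
  rw [abs_of_nonneg (hpos k)] at hk
  have hall : ∀ i, m3 i = m3 k := by
    intro i
    by_contra hne
    have hik : i ≠ k := fun h => hne (by rw [h])
    have hstep := banach_step A hsymm L hL m3 hm3n hm3L i k hik
    have hip : 0 < inner ℝ (m3 i + m3 k) e := by
      rw [inner_add_left]; linarith [hpos i]
    have hne0 : m3 i + m3 k ≠ 0 := by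
      intro h; rw [h] at hip; simp at hip
    set p := m3 i + m3 k with hp
    have hN : 0 < ‖p‖ := norm_pos_iff.2 hne0
    have hN2 : ‖p‖ < 2 := by
      have e6 := parallelogram_law_with_norm ℝ (m3 i) (m3 k)
      rw [hm3n, hm3n, ← hp] at e6
      have : 0 < ‖m3 i - m3 k‖ := norm_pos_iff.2 (sub_ne_zero.2 hne)
      nlinarith
    set z := ‖p‖⁻¹ • p with hz
    have hzn : ‖z‖ = 1 := by
      rw [hz, norm_smul, norm_inv, norm_norm, inv_mul_cancel₀ hN.ne']
    set m4 := Function.update (Function.update m3 i z) k z with hm4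
    have hm4n : ∀ j, ‖m4 j‖ = 1 := by
      intro j
      rw [hm4]
      by_cases h1 : j = k
      · subst h1; simp [hzn]
      · by_cases h2 : j = i
        · subst h2; simp [h1, hzn]
        · simp [h1, h2, hm3n]
    have hA4 : |A m4| = ‖p‖⁻¹ ^ 2 * |A (Function.update (Function.update m3 i p) k p)| := by
      rw [hm4, hz, A.map_update_smul, Function.update_comm hik, A.map_update_smul,
        Function.update_comm hik.symm, smul_smul, smul_eq_mul, abs_mul, abs_of_pos (by positivity)]
      ring
    have hm4L : |A m4| = L := by
      apply le_antisymm (hL1 _ hm4n)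
      rw [hA4]
      calc L = ‖p‖⁻¹ ^ 2 * (L * ‖p‖ ^ 2) := by field_simp
        _ ≤ _ := by gcongr
    have hle := hψ3 m4 hm4n hm4L
    have hsum : ∀ m : Fin (n+1) → E, ψ m = |inner ℝ (m i) e| + (|inner ℝ (m k) e| +
        ∑ j ∈ (Finset.univ.erase i).erase k, |inner ℝ (m j) e|) := by
      intro m
      rw [Finset.add_sum_erase _ (fun j => |inner ℝ (m j) e|) (by simp [hik.symm]),
        Finset.add_sum_erase _ (fun j => |inner ℝ (m j) e|) (by simp)]
    rw [hsum, hsum] at hle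
    have hrest : ∑ j ∈ (Finset.univ.erase i).erase k, |inner ℝ (m4 j) e| =
        ∑ j ∈ (Finset.univ.erase i).erase k, |inner ℝ (m3 j) e| := by
      apply Finset.sum_congr rfl
      intro j hj
      simp only [Finset.mem_erase, Finset.mem_univ, and_true] at hj
      simp [hm4, hj.1, hj.2]
    have h4i : m4 i = z := by simp [hm4, hik]
    have h4k : m4 k = z := by simp [hm4]
    rw [hrest, h4i, h4k, abs_of_nonneg (hpos i), abs_of_nonneg (hpos k)] at hle
    have hzi : inner ℝ z e = ‖p‖⁻¹ * inner ℝ p e := by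
      rw [hz, real_inner_smul_left]
    have hpe : inner ℝ p e = inner ℝ (m3 i) e + inner ℝ (m3 k) e := inner_add_left _ _ _
    have hinv : 1 / 2 < ‖p‖⁻¹ := by
      rw [← one_div]; exact one_div_lt_one_div_of_lt hN hN2
    have habs := le_abs_self (inner ℝ z e : ℝ)
    have : (1/2) * inner ℝ p e < ‖p‖⁻¹ * inner ℝ p e := by gcongr
    linarith
  have : m3 = fun _ => m3 k := funext hall
  rw [← hm3L, this]
  exact hC _ (hm3n k)

lemma taylor_aux (n : ℕ) (K : ℝ) : ∀ (c : ℕ → ℝ → ℝ),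
    (∀ m < n, ∀ t, HasDerivAt (c m) (c (m+1) t) t) →
    (∀ t, 0 ≤ t → |c n t - c n 0| ≤ K * t) → ∀ t, 0 ≤ t →
    |c 0 t - ∑ m ∈ Finset.range (n+1), c m 0 * t ^ m / (m.factorial : ℝ)|
      ≤ K * t ^ (n+1) / ((n+1).factorial : ℝ) := by
  induction n with
  | zero => intro c _ h t ht; simpa using h t ht
  | succ n ih =>
    intro c hd hK t ht
    have h1 := ih (fun m => c (m+1)) (fun m hm t => hd (m+1) (by omega) t) hK
    have hderiv : ∀ y, HasDerivAt (fun y => c 0 y - ∑ m ∈ Finset.range (n+1+1),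
        c m 0 * y ^ m / (m.factorial : ℝ))
        (c 1 y - ∑ m ∈ Finset.range (n+1), c (m+1) 0 * y ^ m / (m.factorial : ℝ)) y := by
      intro y
      refine (hd 0 (by omega) y).sub ?_
      have : HasDerivAt (fun y => ∑ m ∈ Finset.range (n+1+1), c m 0 * y ^ m / (m.factorial : ℝ))
          (∑ m ∈ Finset.range (n+1+1), c m 0 * (m * y ^ (m-1)) / (m.factorial : ℝ)) y := by
        apply HasDerivAt.fun_sum
        intro m _
        exact ((hasDerivAt_pow m y).const_mul _).div_const _
      refine this.congr_deriv ?_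
      rw [Finset.sum_range_succ' _ (n+1)]
      simp only [Nat.cast_zero, zero_mul, mul_zero, zero_div, add_zero]
      apply Finset.sum_congr rfl
      intro m _
      rw [Nat.factorial_succ]
      push_cast
      have : (m.factorial : ℝ) ≠ 0 := by positivity
      have : (m + 1 : ℝ) ≠ 0 := by positivity
      field_simp
    have hB : ∀ y, HasDerivAt (fun y => K * y ^ (n+1+1) / ((n+1+1).factorial : ℝ))
        (K * y ^ (n+1) / ((n+1).factorial : ℝ)) y := by
      intro y
      refine (((hasDerivAt_pow (n+1+1) y).const_mul K).div_const ((n+1+1).factorial : ℝ)).congr_deriv ?_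
      rw [Nat.factorial_succ (n+1)]
      push_cast
      have : ((n+1).factorial : ℝ) ≠ 0 := by positivity
      have : (n + 1 + 1: ℝ) ≠ 0 := by positivity
      field_simp
    have := image_norm_le_of_norm_deriv_right_le_deriv_boundary (a := 0) (b := t)
      (fun y _ => (hderiv y).continuousAt.continuousWithinAt)
      (fun y _ => (hderiv y).hasDerivWithinAt) (B := fun y => K * y ^ (n+1+1) / ((n+1+1).factorial : ℝ))
      (by simp [Finset.sum_range_succ']) hB (fun y hy => h1 y hy.1) (x := t) ⟨ht, le_rfl⟩
    simpa using this

lemma hasFDerivAt_clm_eval {E G : Type*} [NormedAddCommGroup E] [NormedSpace ℝ E]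
    [NormedAddCommGroup G] [NormedSpace ℝ G] {T : E → E →L[ℝ] G} {T' : E →L[ℝ] E →L[ℝ] G} {x : E}
    (h : HasFDerivAt T T' x) (v : E) :
    HasFDerivAt (fun y => T y v) ((ContinuousLinearMap.apply ℝ G v).comp T') x := by
  have h1 : HasFDerivAt (ContinuousLinearMap.apply ℝ G v : (E →L[ℝ] G) → G)
    (ContinuousLinearMap.apply ℝ G v) (T x) := (ContinuousLinearMap.apply ℝ G v).hasFDerivAt
  exact h1.comp x h

lemma fderiv_multilinear_apply {E : Type*} [NormedAddCommGroup E] [NormedSpace ℝ E] {n : ℕ}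
    {T : E → ContinuousMultilinearMap ℝ (fun _ : Fin n => E) ℝ} {x : E}
    (hT : DifferentiableAt ℝ T x) (m : Fin n → E) :
    HasFDerivAt (fun y => T y m)
      ((ContinuousMultilinearMap.apply ℝ (fun _ : Fin n => E) ℝ m).comp (fderiv ℝ T x)) x :=
  (ContinuousMultilinearMap.apply ℝ (fun _ : Fin n => E) ℝ m).hasFDerivAt.comp x hT.hasFDerivAt

lemma iteratedFDeriv_swap {E : Type*} [NormedAddCommGroup E] [NormedSpace ℝ E] {f : E → ℝ} :
    ∀ (n : ℕ), ContDiff ℝ (n + 1 : ℕ) f → ∀ (i : Fin n) (x : E) (m : Fin (n+1) → E),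
      iteratedFDeriv ℝ (n+1) f x (fun j => m (Equiv.swap i.castSucc i.succ j)) =
        iteratedFDeriv ℝ (n+1) f x m := by
  intro n
  induction n with
  | zero => intro _ i; exact i.elim0
  | succ n ih =>
    intro hf i x m
    have hd : ∀ k : ℕ, k < n + 1 + 1 → Differentiable ℝ (iteratedFDeriv ℝ k f) := fun k hk =>
      hf.differentiable_iteratedFDeriv (by exact_mod_cast hk)
    refine Fin.cases ?_ (fun j => ?_) i
    · -- swap of the first two entries
      have key : ∀ (m : Fin (n+1+1) → E), iteratedFDeriv ℝ (n+1+1) f x m =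
          fderiv ℝ (fderiv ℝ (iteratedFDeriv ℝ n f)) x (m 0) (m 1) (Fin.tail (Fin.tail m)) := by
        intro m
        rw [iteratedFDeriv_succ_apply_left]
        have h1 := (fderiv_multilinear_apply (hd (n+1) (by omega) x) (Fin.tail m)).fderiv
        have h2 : (fun y => iteratedFDeriv ℝ (n+1) f y (Fin.tail m)) =
            fun y => (fderiv ℝ (iteratedFDeriv ℝ n f) y (m 1)) (Fin.tail (Fin.tail m)) := by
          funext y
          rw [iteratedFDeriv_succ_apply_left]; rfl
        have h3 : DifferentiableAt ℝ (fderiv ℝ (iteratedFDeriv ℝ n f)) x := by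
          have : ContDiff ℝ (2:ℕ) (iteratedFDeriv ℝ n f) :=
            hf.iteratedFDeriv_right (by norm_cast; omega)
          have h5 : ContDiff ℝ 1 (fderiv ℝ (iteratedFDeriv ℝ n f)) :=
            this.fderiv_right (by norm_num)
          exact (h5.differentiable (by norm_num)) x
        have h4 : HasFDerivAt (fun y => (fderiv ℝ (iteratedFDeriv ℝ n f) y (m 1))
            (Fin.tail (Fin.tail m)))
            ((ContinuousMultilinearMap.apply ℝ (fun _ : Fin n => E) ℝ
              (Fin.tail (Fin.tail m))).comp ((ContinuousLinearMap.apply ℝ _ (m 1)).comp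
                (fderiv ℝ (fderiv ℝ (iteratedFDeriv ℝ n f)) x))) x :=
          (ContinuousMultilinearMap.apply ℝ (fun _ : Fin n => E) ℝ _).hasFDerivAt.comp x
            (hasFDerivAt_clm_eval h3.hasFDerivAt (m 1))
        rw [h2, h4.fderiv] at h1
        have := congrArg (fun T => T (m 0)) h1
        simpa using this.symm
      have hsym : IsSymmSndFDerivAt ℝ (iteratedFDeriv ℝ n f) x := by
        have : ContDiff ℝ (2:ℕ) (iteratedFDeriv ℝ n f) :=
          hf.iteratedFDeriv_right (by norm_cast; omega)
        exact this.contDiffAt.isSymmSndFDerivAt (by simp)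
      rw [key, key, hsym]
      have e0 : Equiv.swap (Fin.castSucc (0 : Fin (n+1))) (Fin.succ 0) 0 = 1 := by
        simp
      have e1 : Equiv.swap (Fin.castSucc (0 : Fin (n+1))) (Fin.succ 0) 1 = 0 := by
        simp
      rw [e0, e1]
      congr 1
    · rw [iteratedFDeriv_succ_apply_left, iteratedFDeriv_succ_apply_left]
      have hf' : ContDiff ℝ (n+1:ℕ) f := hf.of_le (by norm_cast; omega)
      have h0 : Equiv.swap (j.succ.castSucc) (j.succ.succ) 0 = 0 := by
        apply Equiv.swap_apply_of_ne_of_ne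
        · simp [Fin.ext_iff]
        · simp [Fin.ext_iff]
      have ht : Fin.tail (fun l => m (Equiv.swap (j.succ.castSucc) (j.succ.succ) l)) =
          fun l => Fin.tail m (Equiv.swap j.castSucc j.succ l) := by
        funext l
        simp only [Fin.tail]
        congr 1
        rw [← Fin.succ_castSucc, ← (Fin.succ_injective _).map_swap]
      rw [h0, ht]
      have h1 := (fderiv_multilinear_apply (hd (n+1) (by omega) x)
        (fun l => Fin.tail m (Equiv.swap j.castSucc j.succ l))).fderiv
      have h2 := (fderiv_multilinear_apply (hd (n+1) (by omega) x) (Fin.tail m)).fderiv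
      have h3 : (fun y => iteratedFDeriv ℝ (n+1) f y
          (fun l => Fin.tail m (Equiv.swap j.castSucc j.succ l))) =
          fun y => iteratedFDeriv ℝ (n+1) f y (Fin.tail m) := by
        funext y; exact ih hf' j y _
      rw [h3, h2] at h1
      have := congrArg (fun T => T (m 0)) h1
      simpa using this.symm

lemma iteratedFDeriv_perm {E : Type*} [NormedAddCommGroup E] [NormedSpace ℝ E] {f : E → ℝ}
    (n : ℕ) (hf : ContDiff ℝ (n + 1 : ℕ) f) (x : E) (σ : Equiv.Perm (Fin (n+1))) :
    ∀ (m : Fin (n+1) → E),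
      iteratedFDeriv ℝ (n+1) f x (fun j => m (σ j)) = iteratedFDeriv ℝ (n+1) f x m := by
  have hσ : σ ∈ Submonoid.closure (Set.range fun i : Fin n => Equiv.swap i.castSucc i.succ) := by
    rw [Equiv.Perm.mclosure_swap_castSucc_succ]; trivial
  induction hσ using Submonoid.closure_induction with
  | mem τ hτ =>
    obtain ⟨i, rfl⟩ := hτ
    exact iteratedFDeriv_swap n hf i x
  | one => intro m; rfl
  | mul a b _ _ ha hb =>
    intro m
    rw [← ha m]
    exact hb (fun j => m (a j))

lemma smooth_remainder (d n : ℕ) (f : EuclideanSpace ℝ (Fin d) → ℝ) (M : ℝ)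
    (hs : HigherOrderSmooth d (n+2) M f) (x u w : EuclideanSpace ℝ (Fin d)) :
    |fderiv ℝ f (x + w) u - ∑ m ∈ Finset.range (n+1),
        iteratedFDeriv ℝ m (fun y => fderiv ℝ f y u) x (fun _ => w) / (m.factorial : ℝ)|
      ≤ M ^ (n+2) * ‖u‖ * ‖w‖ ^ (n+1) / ((n+1).factorial : ℝ) := by
  obtain ⟨hf, hlip⟩ := hs
  simp only [show n + 2 - 1 = n + 1 from rfl] at hf hlip
  have hF : ContDiff ℝ n (fderiv ℝ f) := hf.fderiv_right (by norm_cast)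
  have hg : ContDiff ℝ n (fun y => fderiv ℝ f y u) := hF.clm_apply contDiff_const
  have hit : ∀ y, iteratedFDeriv ℝ n (fun y => fderiv ℝ f y u) y (fun _ => w) =
      iteratedFDeriv ℝ (n+1) f y (Fin.snoc (fun _ => w) u) := by
    intro y
    rw [iteratedFDeriv_succ_apply_right]
    have := (ContinuousLinearMap.apply ℝ ℝ u).iteratedFDeriv_comp_left (i := n)
      hF.contDiffAt (x := y) le_rfl
    have h2 : (⇑(ContinuousLinearMap.apply ℝ ℝ u) ∘ fderiv ℝ f) = fun y => fderiv ℝ f y u := rfl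
    rw [h2] at this
    rw [this]
    simp
  have hbound : ∀ y, |iteratedFDeriv ℝ n (fun y => fderiv ℝ f y u) y (fun _ => w) -
      iteratedFDeriv ℝ n (fun y => fderiv ℝ f y u) x (fun _ => w)| ≤
      M ^ (n+2) * ‖y - x‖ * (‖w‖ ^ n * ‖u‖) := by
    intro y
    rw [hit, hit]
    have := banach_symm (iteratedFDeriv ℝ (n+1) f y - iteratedFDeriv ℝ (n+1) f x)
      (fun σ m => by
        simp only [ContinuousMultilinearMap.sub_apply]
        rw [iteratedFDeriv_perm n hf y σ m, iteratedFDeriv_perm n hf x σ m])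
      (M ^ (n+2) * ‖y - x‖) (fun v hv => by simpa using hlip y x v hv) (Fin.snoc (fun _ => w) u)
    simpa [Fin.prod_univ_castSucc] using this
  have := taylor_aux n (M ^ (n+2) * ‖u‖ * ‖w‖ ^ (n+1))
    (fun m t => iteratedFDeriv ℝ m (fun y => fderiv ℝ f y u) (x + t • w) (fun _ => w))
    (fun m hm t => by
      have h1 : DifferentiableAt ℝ (iteratedFDeriv ℝ m (fun y => fderiv ℝ f y u)) (x + t • w) :=
        hg.differentiable_iteratedFDeriv (by exact_mod_cast hm) _
      have h2 := fderiv_multilinear_apply h1 (fun _ => w)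
      have h3 : HasDerivAt (fun t : ℝ => x + t • w) w t := by
        simpa using ((hasDerivAt_id t).smul_const w).const_add x
      have h4 := h2.comp_hasDerivAt t h3
      refine h4.congr_deriv ?_
      rw [iteratedFDeriv_succ_apply_left]
      rfl)
    (fun t ht => by
      have := hbound (x + t • w)
      simp only [zero_smul, add_zero]
      refine this.trans (le_of_eq ?_)
      rw [add_sub_cancel_left, norm_smul, Real.norm_of_nonneg ht]
      ring) 1 zero_le_one
  simpa using this

instance intervalUniform_prob : IsProbabilityMeasure intervalUniform := by
  constructor
  simp only [intervalUniform, Measure.smul_apply, Measure.restrict_apply_univ, Real.volume_Icc,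
    smul_eq_mul]
  norm_num
  exact ENNReal.inv_mul_cancel (by norm_num) (by norm_num)

instance ballUniform_prob (d : ℕ) : IsProbabilityMeasure (ballUniform d) := by
  constructor
  simp only [ballUniform, Measure.smul_apply, Measure.restrict_apply_univ, smul_eq_mul]
  exact ENNReal.inv_mul_cancel (measure_closedBall_pos _ _ one_pos).ne' measure_closedBall_lt_top.ne

lemma interval_ae : ∀ᵐ r ∂intervalUniform, r ∈ Set.Icc (-1:ℝ) 1 := by
  apply Measure.ae_smul_measure
  exact ae_restrict_mem measurableSet_Icc

lemma ball_ae (d : ℕ) : ∀ᵐ v ∂ballUniform d, ‖v‖ ≤ 1 := by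
  apply Measure.ae_smul_measure
  filter_upwards [ae_restrict_mem (measurableSet_closedBall)] with v hv
  simpa using hv

lemma prod_ae (d : ℕ) : ∀ᵐ p ∂(intervalUniform.prod (ballUniform d)),
    p.1 ∈ Set.Icc (-1:ℝ) 1 ∧ ‖p.2‖ ≤ 1 := by
  filter_upwards [Measure.quasiMeasurePreserving_fst.ae interval_ae,
    Measure.quasiMeasurePreserving_snd.ae (ball_ae d)] with p h1 h2
  exact ⟨h1, h2⟩

lemma ball_odd (d : ℕ) (h : EuclideanSpace ℝ (Fin d) → ℝ) (hh : ∀ v, h (-v) = - h v) :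
    ∫ v, h v ∂ballUniform d = 0 := by
  have h1 : ∫ v in closedBall (0 : EuclideanSpace ℝ (Fin d)) 1, h v = 0 := by
    rw [← integral_indicator measurableSet_closedBall]
    have := integral_neg_eq_self
      ((closedBall (0 : EuclideanSpace ℝ (Fin d)) 1).indicator h) volume
    have h2 : (fun v => (closedBall (0 : EuclideanSpace ℝ (Fin d)) 1).indicator h (-v)) =
        fun v => - (closedBall (0 : EuclideanSpace ℝ (Fin d)) 1).indicator h v := by
      funext v
      by_cases hv : ‖v‖ ≤ 1
      · rw [Set.indicator_of_mem (by simpa using hv), Set.indicator_of_mem (by simpa using hv), hh]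
      · rw [Set.indicator_of_notMem (by simpa using hv),
          Set.indicator_of_notMem (by simpa using hv), neg_zero]
    rw [h2, integral_neg] at this
    linarith
  rw [ballUniform, integral_smul_measure, h1, smul_zero]

/-- Derivative of the smoothed function. -/
lemma smoothed_hasFDerivAt (d : ℕ) (f : EuclideanSpace ℝ (Fin d) → ℝ) (hf : ContDiff ℝ 1 f)
    (δ : ℝ) (k : ℝ → ℝ) (hkm : Measurable k) (C : ℝ)
    (hC : ∀ r ∈ Set.Icc (-1 : ℝ) 1, |k r| ≤ C) (x : EuclideanSpace ℝ (Fin d)) :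
    Integrable (fun p : ℝ × EuclideanSpace ℝ (Fin d) =>
      (p.1 * k p.1) • fderiv ℝ f (x + (p.1 * δ) • p.2)) (intervalUniform.prod (ballUniform d)) ∧
    HasFDerivAt (smoothed d f δ k) (∫ p : ℝ × EuclideanSpace ℝ (Fin d),
      (p.1 * k p.1) • fderiv ℝ f (x + (p.1 * δ) • p.2)
        ∂(intervalUniform.prod (ballUniform d))) x := by
  have hfc : Continuous (fderiv ℝ f) := hf.continuous_fderiv one_ne_zero
  have hC0 : 0 ≤ C := (abs_nonneg _).trans (hC 0 (by simp))
  have hmk : Measurable fun p : ℝ × EuclideanSpace ℝ (Fin d) => p.1 * k p.1 :=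
    measurable_fst.mul (hkm.comp measurable_fst)
  have hcp : ∀ x : EuclideanSpace ℝ (Fin d),
      Continuous fun p : ℝ × EuclideanSpace ℝ (Fin d) => x + (p.1 * δ) • p.2 := by
    intro x; fun_prop
  have hF' : ∀ x, AEStronglyMeasurable (fun p : ℝ × EuclideanSpace ℝ (Fin d) =>
      (p.1 * k p.1) • fderiv ℝ f (x + (p.1 * δ) • p.2))
      (intervalUniform.prod (ballUniform d)) := fun x =>
    hmk.aestronglyMeasurable.smul (hfc.comp (hcp x)).aestronglyMeasurable
  have hF : ∀ x, AEStronglyMeasurable (fun p : ℝ × EuclideanSpace ℝ (Fin d) =>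
      f (x + (p.1 * δ) • p.2) * (p.1 * k p.1))
      (intervalUniform.prod (ballUniform d)) := fun x =>
    (hf.continuous.comp (hcp x)).aestronglyMeasurable.mul hmk.aestronglyMeasurable
  obtain ⟨D, hD⟩ := (isCompact_closedBall x (1 + |δ|)).exists_bound_of_continuousOn hfc.continuousOn
  obtain ⟨D', hD'⟩ := (isCompact_closedBall x (1 + |δ|)).exists_bound_of_continuousOn
    hf.continuous.continuousOn
  have hin : ∀ p : ℝ × EuclideanSpace ℝ (Fin d), p.1 ∈ Set.Icc (-1:ℝ) 1 ∧ ‖p.2‖ ≤ 1 →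
      ∀ y ∈ ball x 1, y + (p.1 * δ) • p.2 ∈ closedBall x (1 + |δ|) := by
    rintro ⟨r, v⟩ ⟨hr, hv⟩ y hy
    have hr' : |r| ≤ 1 := abs_le.2 hr
    rw [mem_closedBall, dist_eq_norm]
    rw [mem_ball, dist_eq_norm] at hy
    calc ‖y + (r * δ) • v - x‖ = ‖(y - x) + (r * δ) • v‖ := by congr 1; abel
      _ ≤ ‖y - x‖ + ‖(r * δ) • v‖ := norm_add_le _ _
      _ ≤ 1 + |δ| := by
        rw [norm_smul, Real.norm_eq_abs, abs_mul]
        have : |r| * |δ| * ‖v‖ ≤ 1 * |δ| * 1 := by gcongr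
        linarith
  have hrk : ∀ r ∈ Set.Icc (-1:ℝ) 1, |r * k r| ≤ C := by
    intro r hr
    rw [abs_mul]
    calc |r| * |k r| ≤ 1 * C := by gcongr; exact abs_le.2 hr; exact hC r hr
      _ = C := one_mul C
  have hb : ∀ᵐ p ∂(intervalUniform.prod (ballUniform d)), ∀ y ∈ ball x 1,
      ‖(p.1 * k p.1) • fderiv ℝ f (y + (p.1 * δ) • p.2)‖ ≤ C * D := by
    filter_upwards [prod_ae d] with p hp y hy
    rw [norm_smul, Real.norm_eq_abs]
    gcongr
    · exact hrk _ hp.1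
    · exact hD _ (hin p hp y hy)
  refine ⟨(integrable_const (C * D)).mono' (hF' x)
    (hb.mono fun p hp => hp x (mem_ball_self one_pos)), ?_⟩
  refine hasFDerivAt_integral_of_dominated_of_fderiv_le (bound := fun _ => C * D)
    (ball_mem_nhds x one_pos) (Filter.Eventually.of_forall hF) ?_ (hF' x) hb
    (integrable_const _) ?_
  · refine (integrable_const (D' * C)).mono' (hF x) ?_
    filter_upwards [prod_ae d] with p hp
    have h1 := hD' _ (hin p hp x (mem_ball_self one_pos))
    rw [norm_mul]
    gcongr
    · exact (norm_nonneg _).trans h1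
    · exact hrk _ hp.1
  · refine Filter.Eventually.of_forall fun p y _ => ?_
    have h1 : HasFDerivAt f (fderiv ℝ f (y + (p.1 * δ) • p.2)) (y + (p.1 * δ) • p.2) :=
      (hf.differentiable one_ne_zero _).hasFDerivAt
    have h2 : HasFDerivAt (fun y => f (y + (p.1 * δ) • p.2))
        (fderiv ℝ f (y + (p.1 * δ) • p.2)) y := by
      rwa [hasFDerivAt_comp_add_right]
    exact h2.mul_const _

lemma interval_integrable (k : ℝ → ℝ) (hkm : Measurable k) (C : ℝ)
    (hC : ∀ r ∈ Set.Icc (-1 : ℝ) 1, |k r| ≤ C) (s : ℕ) :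
    Integrable (fun r => r ^ s * k r) intervalUniform := by
  refine (integrable_const C).mono' (by fun_prop) ?_
  filter_upwards [interval_ae] with r hr
  rw [norm_mul, norm_pow, Real.norm_eq_abs, Real.norm_eq_abs]
  calc |r| ^ s * |k r| ≤ 1 * C := by
        gcongr
        · exact pow_le_one₀ (abs_nonneg _) (abs_le.2 hr)
        · exact hC r hr
    _ = C := one_mul C

lemma ball_integrable (d : ℕ) (m : ℕ)
    (T : ContinuousMultilinearMap ℝ (fun _ : Fin m => EuclideanSpace ℝ (Fin d)) ℝ) :
    Integrable (fun v => T (fun _ => v)) (ballUniform d) := by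
  have hc : Continuous fun v : EuclideanSpace ℝ (Fin d) => T (fun _ => v) :=
    T.cont.comp (continuous_pi fun _ => continuous_id)
  refine (integrable_const ‖T‖).mono' hc.aestronglyMeasurable ?_
  filter_upwards [ball_ae d] with v hv
  refine (T.le_opNorm _).trans ?_
  simp only [Finset.prod_const]
  exact mul_le_of_le_one_right (norm_nonneg _) (pow_le_one₀ (norm_nonneg _) hv)

theorem stmt_3 (d : ℕ) (hd : 1 ≤ d) (β : ℕ) (hβ : 2 ≤ β)
    (f : EuclideanSpace ℝ (Fin d) → ℝ) (hconv : ConvexOn ℝ Set.univ f)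
    (hdiff : Differentiable ℝ f)
    (Mβ : ℝ) (hMβ : 0 < Mβ) (hsmooth : HigherOrderSmooth d β Mβ f)
    (δ : ℝ) (hδ : 0 < δ)
    (k : ℝ → ℝ) (hkmeas : Measurable k) (hkbdd : ∃ C, ∀ r ∈ Set.Icc (-1 : ℝ) 1, |k r| ≤ C)
    (hk1 : ∫ r, r * k r ∂intervalUniform = 1)
    (hkodd : ∀ s : ℕ, Odd s → 3 ≤ s → s ≤ β → ∫ r, r ^ s * k r ∂intervalUniform = 0) :
    ∀ x : EuclideanSpace ℝ (Fin d),
      ‖gradient (smoothed d f δ k) x - gradient f x‖ ≤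
        Mβ ^ β / (Nat.factorial (β - 1)) * δ ^ (β - 1) *
          ∫ r, |k r * r ^ β| ∂intervalUniform := by
  intro x
  obtain ⟨n, rfl⟩ : ∃ n, β = n + 2 := ⟨β - 2, by omega⟩
  simp only [show n + 2 - 1 = n + 1 from rfl]
  obtain ⟨C, hC⟩ := hkbdd
  have hf1 : ContDiff ℝ 1 f := hsmooth.1.of_le (by
    simp only [show n + 2 - 1 = n + 1 from rfl]; norm_cast; omega)
  obtain ⟨hint, hder⟩ := smoothed_hasFDerivAt d f hf1 δ k hkmeas C hC x
  have hI0 : 0 ≤ ∫ r, |k r * r ^ (n+2)| ∂intervalUniform :=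
    integral_nonneg fun r => abs_nonneg _
  have hnorm : ‖gradient (smoothed d f δ k) x - gradient f x‖ =
      ‖fderiv ℝ (smoothed d f δ k) x - fderiv ℝ f x‖ := by
    rw [gradient, gradient, ← map_sub, LinearIsometryEquiv.norm_map]
  rw [hnorm]
  refine ContinuousLinearMap.opNorm_le_bound _ (by positivity) fun u => ?_
  rw [ContinuousLinearMap.sub_apply, hder.fderiv, ContinuousLinearMap.integral_apply hint]
  simp only [ContinuousLinearMap.smul_apply, smul_eq_mul]
  set T : (m : ℕ) → ContinuousMultilinearMap ℝ (fun _ : Fin m => EuclideanSpace ℝ (Fin d)) ℝ :=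
    fun m => iteratedFDeriv ℝ m (fun y => fderiv ℝ f y u) x with hT
  set P : ℝ × EuclideanSpace ℝ (Fin d) → ℝ := fun p => ∑ m ∈ Finset.range (n+1),
    (δ ^ m / (m.factorial : ℝ)) * ((p.1 ^ (m+1) * k p.1) * T m (fun _ => p.2)) with hP
  have hPi : ∀ m, Integrable (fun p : ℝ × EuclideanSpace ℝ (Fin d) =>
      (δ ^ m / (m.factorial : ℝ)) * ((p.1 ^ (m+1) * k p.1) * T m (fun _ => p.2)))
      (intervalUniform.prod (ballUniform d)) := fun m =>
    ((interval_integrable k hkmeas C hC (m+1)).mul_prod (ball_integrable d m (T m))).const_mul _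
  have hPint : Integrable P (intervalUniform.prod (ballUniform d)) :=
    integrable_finset_sum _ fun m _ => hPi m
  have hPval : ∫ p, P p ∂(intervalUniform.prod (ballUniform d)) = fderiv ℝ f x u := by
    rw [hP, integral_finset_sum _ fun m _ => hPi m]
    have hterm : ∀ m, ∫ p : ℝ × EuclideanSpace ℝ (Fin d),
        (δ ^ m / (m.factorial : ℝ)) * ((p.1 ^ (m+1) * k p.1) * T m (fun _ => p.2))
          ∂(intervalUniform.prod (ballUniform d)) =
        (δ ^ m / (m.factorial : ℝ)) * ((∫ r, r ^ (m+1) * k r ∂intervalUniform) *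
          ∫ v, T m (fun _ => v) ∂ballUniform d) := by
      intro m
      rw [integral_const_mul]
      congr 1
      exact integral_prod_mul (fun r => r ^ (m+1) * k r) (fun v => T m (fun _ => v))
    rw [Finset.sum_eq_single 0]
    · rw [hterm]
      simp [hk1, hT]
    · intro m hm hm0
      rw [hterm]
      rcases Nat.even_or_odd m with he | ho
      · have : ∫ r, r ^ (m+1) * k r ∂intervalUniform = 0 := by
          apply hkodd _ he.add_one
          · obtain ⟨j, hj⟩ := he; omega
          · have := Finset.mem_range.1 hm; omega
        rw [this]; ring
      · have : ∫ v, T m (fun _ => v) ∂ballUniform d = 0 := by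
          apply ball_odd
          intro v
          have := (T m).map_smul_univ (fun _ => (-1 : ℝ)) (fun _ => v)
          simpa [ho.neg_one_pow] using this
        rw [this]; ring
    · simp
  rw [← hPval]
  have hint2 : Integrable (fun p : ℝ × EuclideanSpace ℝ (Fin d) =>
      p.1 * k p.1 * fderiv ℝ f (x + (p.1 * δ) • p.2) u)
      (intervalUniform.prod (ballUniform d)) := by
    simpa using hint.apply_continuousLinearMap u
  rw [← integral_sub hint2 hPint]
  set c : ℝ := Mβ ^ (n+2) / ((n+1).factorial : ℝ) * δ ^ (n+1) * ‖u‖ with hc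
  have hkint : Integrable (fun r => c * |k r * r ^ (n+2)|) intervalUniform := by
    have := (interval_integrable k hkmeas C hC (n+2)).abs.const_mul c
    simpa only [mul_comm (k _)] using this
  have hB : ∀ᵐ p ∂(intervalUniform.prod (ballUniform d)),
      ‖p.1 * k p.1 * fderiv ℝ f (x + (p.1 * δ) • p.2) u - P p‖ ≤ c * |k p.1 * p.1 ^ (n+2)| := by
    filter_upwards [prod_ae d] with p hp
    have hrem := smooth_remainder d n f Mβ hsmooth x u ((p.1 * δ) • p.2)
    have hPp : P p = p.1 * k p.1 * ∑ m ∈ Finset.range (n+1),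
        iteratedFDeriv ℝ m (fun y => fderiv ℝ f y u) x (fun _ => (p.1 * δ) • p.2) /
          (m.factorial : ℝ) := by
      rw [hP, Finset.mul_sum]
      apply Finset.sum_congr rfl
      intro m _
      have := (T m).map_smul_univ (fun _ => p.1 * δ) (fun _ => p.2)
      simp only [Finset.prod_const, Finset.card_univ, Fintype.card_fin, smul_eq_mul] at this
      rw [hT] at this ⊢
      rw [this]
      ring
    rw [hPp, ← mul_sub, norm_mul]
    simp only [Real.norm_eq_abs]
    refine (mul_le_mul_of_nonneg_left hrem (abs_nonneg _)).trans ?_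
    rw [norm_smul, Real.norm_eq_abs, abs_mul p.1 δ, abs_of_pos hδ, hc, abs_mul, abs_mul, abs_pow]
    have hv : ‖p.2‖ ^ (n+1) ≤ 1 := pow_le_one₀ (norm_nonneg _) hp.2
    calc |p.1| * |k p.1| * (Mβ ^ (n+2) * ‖u‖ * (|p.1| * δ * ‖p.2‖) ^ (n+1) /
          ((n+1).factorial : ℝ)) =
        (Mβ ^ (n+2) / ((n+1).factorial : ℝ) * δ ^ (n+1) * ‖u‖ * (|k p.1| * |p.1| ^ (n+2))) *
          ‖p.2‖ ^ (n+1) := by ring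
      _ ≤ _ := mul_le_of_le_one_right (by positivity) hv
  refine (norm_integral_le_of_norm_le (hkint.comp_fst _) hB).trans (le_of_eq ?_)
  rw [integral_fun_fst (fun r => c * |k r * r ^ (n+2)|), integral_const_mul]
  simp only [probReal_univ, one_smul, hc]
  ring
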